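/- For M̄ > 0, ∫∫_{(-π,π]×ℝ} ( (p²/2)·⟨cos q⟩_J + M̄/4 ) dq dp = M̄ ∫∫_{(-π,π]×ℝ} ⟨cos q⟩_J² dq dp, where ⟨cos q⟩_J is the pendulum angle-average of cos q with modulus k² = (p²+2M̄(1−cos q))/(4M̄). -/

import Mathlib

open Real MeasureTheory

noncomputable def ellK (k : ℝ) : ℝ :=
  ∫ φ in (0:ℝ)..(Real.pi/2), 1 / Real.sqrt (1 - k^2 * Real.sin φ ^ 2)

noncomputable def ellE (k : ℝ) : ℝ :=
  ∫ φ in (0:ℝ)..(Real.pi/2), Real.sqrt (1 - k^2 * Real.sin φ ^ 2)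

noncomputable def modk (M q p : ℝ) : ℝ :=
  Real.sqrt ((p^2 + 2*M*(1 - Real.cos q)) / (4*M))

noncomputable def avgcos (M q p : ℝ) : ℝ :=
  if modk M q p < 1 then 2 * ellE (modk M q p) / ellK (modk M q p) - 1
  else 2 * (modk M q p)^2 * ellE (1 / modk M q p) / ellK (1 / modk M q p)
    - 2 * (modk M q p)^2 + 1

/-- The angle average of `cos q` as a function of the squared modulus `u = k²`. -/
noncomputable def avgcosOfSq (u : ℝ) : ℝ :=
  if √u < 1 then 2 * ellE (√u) / ellK (√u) - 1
  else 2 * (√u)^2 * ellE (1 / √u) / ellK (1 / √u) - 2 * (√u)^2 + 1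

lemma avgcos_eq_avgcosOfSq (M q p : ℝ) :
    avgcos M q p = avgcosOfSq ((p^2 + 2*M*(1 - cos q)) / (4*M)) := rfl

lemma measurable_ellK : Measurable ellK := by
  unfold ellK
  simp only [intervalIntegral.integral_of_le (by positivity : (0:ℝ) ≤ π / 2)]
  exact (StronglyMeasurable.integral_prod_right (f := fun k φ : ℝ => 1 / √(1 - k^2 * sin φ ^ 2))
    (Measurable.stronglyMeasurable (by unfold Function.uncurry; fun_prop))).measurable

lemma measurable_ellE : Measurable ellE := by
  unfold ellE
  simp only [intervalIntegral.integral_of_le (by positivity : (0:ℝ) ≤ π / 2)]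
  exact (StronglyMeasurable.integral_prod_right (f := fun k φ : ℝ => √(1 - k^2 * sin φ ^ 2))
    (Measurable.stronglyMeasurable (by unfold Function.uncurry; fun_prop))).measurable

lemma measurable_avgcosOfSq : Measurable avgcosOfSq := by
  have hK := measurable_ellK
  have hE := measurable_ellE
  unfold avgcosOfSq
  refine Measurable.ite (measurableSet_lt (by fun_prop) (by fun_prop)) ?_ ?_ <;> fun_prop

lemma one_sub_sq_mul_sin_sq_pos {k : ℝ} (hk : k ^ 2 < 1) (φ : ℝ) :
    0 < 1 - k ^ 2 * sin φ ^ 2 := by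
  nlinarith [sin_sq_le_one φ, sq_nonneg k, sq_nonneg (sin φ)]

lemma continuous_inv_sqrt_one_sub {k : ℝ} (hk : k ^ 2 < 1) :
    Continuous fun φ => 1 / √(1 - k ^ 2 * sin φ ^ 2) :=
  continuous_const.div (by fun_prop)
    fun φ => (sqrt_pos.2 (one_sub_sq_mul_sin_sq_pos hk φ)).ne'

lemma pi_div_two_le_ellK {k : ℝ} (hk : k ^ 2 < 1) : π / 2 ≤ ellK k := by
  have h : ∫ _ in (0:ℝ)..(π / 2), (1:ℝ) ≤ ellK k := by
    refine intervalIntegral.integral_mono_on (by positivity) (by simp)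
      ((continuous_inv_sqrt_one_sub hk).intervalIntegrable _ _) fun φ _ => ?_
    rw [le_div_iff₀ (sqrt_pos.2 (one_sub_sq_mul_sin_sq_pos hk φ)), one_mul]
    exact sqrt_le_one.2 (by nlinarith [mul_nonneg (sq_nonneg k) (sq_nonneg (sin φ))])
  simpa using h

lemma ellK_pos {k : ℝ} (hk : k ^ 2 < 1) : 0 < ellK k :=
  lt_of_lt_of_le (by positivity) (pi_div_two_le_ellK hk)

lemma integral_affine_div_sqrt {k : ℝ} (hk : k ^ 2 < 1) (a b : ℝ) :
    ∫ φ in (0:ℝ)..(π / 2), (a + b * (1 - k ^ 2 * sin φ ^ 2)) / √(1 - k ^ 2 * sin φ ^ 2)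
      = a * ellK k + b * ellE k := by
  unfold ellK ellE
  rw [← intervalIntegral.integral_const_mul, ← intervalIntegral.integral_const_mul,
    ← intervalIntegral.integral_add
      (((continuous_inv_sqrt_one_sub hk).intervalIntegrable _ _).const_mul _)
      ((Continuous.intervalIntegrable (by fun_prop) _ _))]
  refine intervalIntegral.integral_congr fun φ _ => ?_
  have h := one_sub_sq_mul_sin_sq_pos hk φ
  have h' := sqrt_pos.2 h
  have h2 := sq_sqrt h.le
  field_simp
  rw [h2]

lemma avgcosOfSq_mul_ellK_of_lt_one {u : ℝ} (hu : u < 1) :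
    avgcosOfSq u * ellK (√u) = 2 * ellE (√u) - ellK (√u) := by
  have h1 : √u < 1 := by rwa [sqrt_lt' one_pos, one_pow]
  have hk : √u ^ 2 < 1 := by nlinarith [sqrt_nonneg u]
  have := ellK_pos hk
  rw [avgcosOfSq, if_pos h1]
  field_simp

lemma sq_one_div_sqrt_lt_one {u : ℝ} (hu : 1 < u) : (1 / √u) ^ 2 < 1 := by
  rw [div_pow, sq_sqrt (by linarith), one_pow, div_lt_one (by linarith)]
  exact hu

lemma avgcosOfSq_mul_ellK_of_one_lt {u : ℝ} (hu : 1 < u) :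
    avgcosOfSq u * ellK (1 / √u)
      = 2 * u * ellE (1 / √u) - (2 * u - 1) * ellK (1 / √u) := by
  have h1 : ¬ √u < 1 := by
    rw [not_lt]; exact one_le_sqrt.2 hu.le
  have := ellK_pos (sq_one_div_sqrt_lt_one hu)
  rw [avgcosOfSq, if_neg h1, sq_sqrt (by linarith)]
  field_simp
  ring

lemma avgcosOfSq_mul_ellK_eq_integral {u : ℝ} (hu : 1 < u) :
    avgcosOfSq u * ellK (1 / √u)
      = ∫ φ in (0:ℝ)..(π / 2),
          (1 - 2 * sin φ ^ 2) / √(1 - (1 / √u) ^ 2 * sin φ ^ 2) := by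
  rw [avgcosOfSq_mul_ellK_of_one_lt hu]
  have h := integral_affine_div_sqrt (sq_one_div_sqrt_lt_one hu) (-(2 * u - 1)) (2 * u)
  rw [show 2 * u * ellE (1 / √u) - (2 * u - 1) * ellK (1 / √u)
    = -(2 * u - 1) * ellK (1 / √u) + 2 * u * ellE (1 / √u) by ring, ← h]
  refine intervalIntegral.integral_congr fun φ _ => ?_
  have h2 : (1 / √u) ^ 2 = 1 / u := by rw [div_pow, sq_sqrt (by linarith), one_pow]
  simp only [h2]
  congr 1
  field_simp
  ring

lemma abs_avgcosOfSq_le_one_of_lt_one {u : ℝ} (hu : u < 1) : |avgcosOfSq u| ≤ 1 := by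
  have hk : √u ^ 2 < 1 := by
    have : √u < 1 := by rwa [sqrt_lt' one_pos, one_pow]
    nlinarith [sqrt_nonneg u]
  have hK := ellK_pos hk
  have h := avgcosOfSq_mul_ellK_of_lt_one hu
  have hE : 0 ≤ ellE (√u) :=
    intervalIntegral.integral_nonneg (by positivity) fun _ _ => sqrt_nonneg _
  have hEK : ellE (√u) ≤ ellK (√u) := by
    refine intervalIntegral.integral_mono_on (by positivity)
      (Continuous.intervalIntegrable (by fun_prop) _ _)
      ((continuous_inv_sqrt_one_sub hk).intervalIntegrable _ _) fun φ _ => ?_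
    have h0 := one_sub_sq_mul_sin_sq_pos hk φ
    rw [le_div_iff₀ (sqrt_pos.2 h0), mul_self_sqrt h0.le]
    nlinarith [mul_nonneg (sq_nonneg (√u)) (sq_nonneg (sin φ))]
  rw [abs_le]
  constructor <;> refine le_of_mul_le_mul_right ?_ hK <;> linarith

lemma abs_avgcosOfSq_le_one_of_one_lt {u : ℝ} (hu : 1 < u) : |avgcosOfSq u| ≤ 1 := by
  have hk := sq_one_div_sqrt_lt_one hu
  have hK := ellK_pos hk
  refine le_of_mul_le_mul_right ?_ hK
  rw [← abs_of_pos hK, ← abs_mul, avgcosOfSq_mul_ellK_eq_integral hu, abs_of_pos hK, one_mul,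
    ← Real.norm_eq_abs]
  refine intervalIntegral.norm_integral_le_of_norm_le (by positivity) (ae_of_all _ fun φ _ => ?_)
    ((continuous_inv_sqrt_one_sub hk).intervalIntegrable _ _)
  rw [norm_div, Real.norm_of_nonneg (sqrt_nonneg _), Real.norm_eq_abs]
  gcongr
  rw [abs_le]
  constructor <;> nlinarith [sin_sq_le_one φ, sq_nonneg (sin φ)]

lemma exists_abs_avgcosOfSq_le : ∃ C : ℝ, 1 ≤ C ∧ ∀ u, |avgcosOfSq u| ≤ C := by
  refine ⟨1 + |avgcosOfSq 1|, by simp, fun u => ?_⟩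
  have h0 := abs_nonneg (avgcosOfSq 1)
  rcases lt_trichotomy u 1 with h | rfl | h
  · linarith [abs_avgcosOfSq_le_one_of_lt_one h]
  · linarith
  · linarith [abs_avgcosOfSq_le_one_of_one_lt h]

lemma abs_one_div_sqrt_one_sub_sub_le {x : ℝ} (h0 : 0 ≤ x) (h1 : x ≤ 1 / 2) :
    |1 / √(1 - x) - (1 + x / 2)| ≤ x ^ 2 := by
  obtain ⟨w, hw⟩ : ∃ w, w = √(1 - x) := ⟨_, rfl⟩
  have hw2 : w ^ 2 = 1 - x := by rw [hw, sq_sqrt (by linarith)]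
  have hx : x = 1 - w ^ 2 := by linarith
  have hwlo : 7 / 10 ≤ w := by
    rw [hw]; exact le_sqrt_of_sq_le (by linarith)
  rw [← hw, show 1 / w - (1 + x / 2) = (1 - w) ^ 2 * ((w + 2) / (2 * w)) by
    rw [hx]; field_simp; ring, abs_of_nonneg (by positivity),
    show x ^ 2 = (1 - w) ^ 2 * (1 + w) ^ 2 by rw [hx]; ring]
  gcongr
  rw [div_le_iff₀ (by positivity)]
  nlinarith [mul_nonneg (sub_nonneg.2 hwlo) (sub_nonneg.2 hwlo)]

lemma integral_quartic_sin (a b c : ℝ) :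
    ∫ φ in (0:ℝ)..(π / 2), (a + b * sin φ ^ 2 + c * sin φ ^ 4)
      = a * (π / 2) + b * (π / 4) + c * (3 * π / 16) := by
  have h2 : ∫ φ in (0:ℝ)..(π / 2), sin φ ^ 2 = π / 4 := by
    rw [integral_sin_sq]; simp; ring
  have h4 : ∫ φ in (0:ℝ)..(π / 2), sin φ ^ 4 = 3 * π / 16 := by
    rw [integral_sin_pow (n := 2), h2]; simp; ring
  rw [intervalIntegral.integral_add (Continuous.intervalIntegrable (by fun_prop) _ _)
    (Continuous.intervalIntegrable (by fun_prop) _ _),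
    intervalIntegral.integral_add (Continuous.intervalIntegrable (by fun_prop) _ _)
    (Continuous.intervalIntegrable (by fun_prop) _ _)]
  simp only [intervalIntegral.integral_const_mul, h2, h4, intervalIntegral.integral_const]
  simp
  ring

/-- Leading asymptotics of the averaged cosine for fast rotations. -/
lemma abs_avgcosOfSq_add_le {u : ℝ} (hu : 2 ≤ u) :
    |avgcosOfSq u + 1 / (8 * u)| ≤ 3 / u ^ 2 := by
  have hu1 : 1 < u := by linarith
  have hk := sq_one_div_sqrt_lt_one hu1
  have hK := pi_div_two_le_ellK hk
  have hKpos := ellK_pos hk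
  obtain ⟨m, hm⟩ : ∃ m, m = 1 / u := ⟨_, rfl⟩
  have hm0 : 0 < m := by rw [hm]; positivity
  have hm1 : m ≤ 1 / 2 := by rw [hm]; exact one_div_le_one_div_of_le two_pos hu
  have hkm : (1 / √u) ^ 2 = m := by rw [div_pow, sq_sqrt (by linarith), one_pow, hm]
  have hcont := continuous_inv_sqrt_one_sub hk
  have hcont' : Continuous fun φ => (1 - 2 * sin φ ^ 2) / √(1 - (1 / √u) ^ 2 * sin φ ^ 2) :=
    Continuous.div (by fun_prop) (by fun_prop)
      fun φ => (sqrt_pos.2 (one_sub_sq_mul_sin_sq_pos hk φ)).ne'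
  have key : (avgcosOfSq u + m / 8) * ellK (1 / √u) - m ^ 2 * π / 64
      = ∫ φ in (0:ℝ)..(π / 2), (1 - 2 * sin φ ^ 2 + m / 8) *
          (1 / √(1 - (1 / √u) ^ 2 * sin φ ^ 2) - (1 + m * sin φ ^ 2 / 2)) := by
    have hpoly := integral_quartic_sin (1 + m / 8) (-2 + m / 2 + m ^ 2 / 16) (-m)
    rw [show m ^ 2 * π / 64 = (1 + m / 8) * (π / 2) + (-2 + m / 2 + m ^ 2 / 16) * (π / 4)
      + (-m) * (3 * π / 16) by ring, ← hpoly, add_mul, avgcosOfSq_mul_ellK_eq_integral hu1, ellK,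
      ← intervalIntegral.integral_const_mul, ← intervalIntegral.integral_add,
      ← intervalIntegral.integral_sub]
    · refine intervalIntegral.integral_congr fun φ _ => ?_
      ring
    · exact (hcont'.add (hcont.const_mul _)).intervalIntegrable _ _
    · exact Continuous.intervalIntegrable (by fun_prop) _ _
    · exact hcont'.intervalIntegrable _ _
    · exact Continuous.intervalIntegrable (by fun_prop) _ _
  have hbound : |(avgcosOfSq u + m / 8) * ellK (1 / √u) - m ^ 2 * π / 64|
      ≤ (2 * m ^ 2) * |π / 2 - 0| := by
    rw [key, ← Real.norm_eq_abs]
    refine intervalIntegral.norm_integral_le_of_norm_le_const fun φ _ => ?_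
    have hs0 := sq_nonneg (sin φ)
    have hs1 := sin_sq_le_one φ
    rw [norm_mul, hkm, Real.norm_eq_abs, Real.norm_eq_abs]
    have h1 : |1 - 2 * sin φ ^ 2 + m / 8| ≤ 2 := by
      rw [abs_le]; constructor <;> linarith
    have h2 := abs_one_div_sqrt_one_sub_sub_le (x := m * sin φ ^ 2) (by positivity) (by nlinarith)
    have h3 : (m * sin φ ^ 2) ^ 2 ≤ m ^ 2 :=
      pow_le_pow_left₀ (by positivity) (by nlinarith) 2
    exact mul_le_mul h1 (h2.trans h3) (abs_nonneg _) (by norm_num)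
  rw [show 1 / (8 * u) = m / 8 by rw [hm]; field_simp,
    show 3 / u ^ 2 = 3 * m ^ 2 by rw [hm]; field_simp]
  refine le_of_mul_le_mul_right ?_ hKpos
  rw [← abs_of_pos hKpos, ← abs_mul, abs_of_pos hKpos]
  have h5 := abs_sub_abs_le_abs_sub ((avgcosOfSq u + m / 8) * ellK (1 / √u)) (m ^ 2 * π / 64)
  rw [abs_of_nonneg (by positivity : 0 ≤ m ^ 2 * π / 64)] at h5
  rw [sub_zero, abs_of_pos pi_div_two_pos] at hbound
  have h6 : 3 * m ^ 2 * (π / 2) ≤ 3 * m ^ 2 * ellK (1 / √u) := by gcongr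
  have h7 : 0 < m ^ 2 * π := by positivity
  linarith

lemma integral_comp_cos_Ioc (h : ℝ → ℝ) :
    ∫ q in Set.Ioc (-π) π, h (cos q) = 4 * ∫ θ in (0:ℝ)..(π / 2), h (1 - 2 * sin θ ^ 2) := by
  have habs : ∀ q : ℝ, (Set.Icc (-π) π).indicator (fun q => h (cos q)) q
      = (Set.Iic π).indicator (fun q => h (cos q)) |q| := fun q => by
    simp only [Set.indicator_apply, Set.mem_Icc, Set.mem_Iic, abs_le, cos_abs]
  have hdouble := intervalIntegral.integral_comp_mul_left (a := 0) (b := π / 2)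
    (fun q => h (cos q)) (two_ne_zero (α := ℝ))
  rw [← integral_Icc_eq_integral_Ioc, ← integral_indicator measurableSet_Icc]
  simp_rw [habs]
  rw [integral_comp_abs, setIntegral_indicator measurableSet_Iic, Set.Ioi_inter_Iic,
    ← intervalIntegral.integral_of_le pi_pos.le]
  simp_rw [show ∀ θ, 1 - 2 * sin θ ^ 2 = cos (2 * θ) by
    intro θ; rw [cos_two_mul, cos_sq']; ring]
  rw [hdouble, mul_zero, mul_div_cancel₀ π two_ne_zero, smul_eq_mul]
  ring

lemma image_arcsin_mul_sin {k : ℝ} (hk0 : 0 < k) (hk1 : k < 1) :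
    (fun φ => arcsin (k * sin φ)) '' Set.Ioo 0 (π / 2) = Set.Ioo 0 (arcsin k) := by
  ext θ
  simp only [Set.mem_image, Set.mem_Ioo]
  constructor
  · rintro ⟨φ, ⟨h0, h1⟩, rfl⟩
    have hs0 : 0 < sin φ := sin_pos_of_pos_of_lt_pi h0 (by linarith [pi_pos])
    have hs1 : sin φ < 1 := by
      rw [← sin_pi_div_two]
      exact sin_lt_sin_of_lt_of_le_pi_div_two (by linarith) le_rfl h1
    refine ⟨arcsin_pos.2 (by positivity), arcsin_lt_arcsin ?_ ?_ hk1.le⟩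
    · nlinarith
    · nlinarith
  · rintro ⟨h0, h1⟩
    have hpi := arcsin_le_pi_div_two k
    have hs0 : 0 < sin θ := sin_pos_of_pos_of_lt_pi h0 (by linarith [pi_pos])
    have hs1 : sin θ < k := by
      rw [← sin_arcsin (x := k) (by linarith) hk1.le]
      exact sin_lt_sin_of_lt_of_le_pi_div_two (by linarith) hpi h1
    have hd0 : 0 < sin θ / k := by positivity
    have hd1 : sin θ / k < 1 := (div_lt_one hk0).2 hs1
    refine ⟨arcsin (sin θ / k), ⟨arcsin_pos.2 hd0, arcsin_lt_pi_div_two.2 hd1⟩, ?_⟩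
    rw [sin_arcsin (by linarith) hd1.le, mul_div_cancel₀ _ hk0.ne',
      arcsin_sin (by linarith) (by linarith)]

lemma integral_div_sqrt_sub_sin_sq {k : ℝ} (hk0 : 0 < k) (hk1 : k < 1) (h : ℝ → ℝ) :
    ∫ θ in (0:ℝ)..(π / 2), h (sin θ ^ 2) / √(k ^ 2 - sin θ ^ 2)
      = ∫ φ in (0:ℝ)..(π / 2), h (k ^ 2 * sin φ ^ 2) / √(1 - k ^ 2 * sin φ ^ 2) := by
  have hpi := arcsin_le_pi_div_two k
  have hrange : ∀ φ, -1 < k * sin φ ∧ k * sin φ < 1 := fun φ => by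
    constructor <;> nlinarith [sin_le_one φ, neg_one_le_sin φ]
  have hderiv : ∀ φ ∈ Set.Ioo 0 (π / 2), HasDerivWithinAt (fun φ => arcsin (k * sin φ))
      (1 / √(1 - (k * sin φ) ^ 2) * (k * cos φ)) (Set.Ioo 0 (π / 2)) φ := fun φ _ =>
    (HasDerivAt.comp (h₂ := arcsin) (h := fun φ => k * sin φ) φ
      (hasDerivAt_arcsin (hrange φ).1.ne' (hrange φ).2.ne)
      ((hasDerivAt_sin φ).const_mul k)).hasDerivWithinAt
  have hinj : Set.InjOn (fun φ => arcsin (k * sin φ)) (Set.Ioo 0 (π / 2)) := by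
    intro x hx y hy hxy
    have h1 := (arcsin_inj (hrange x).1.le (hrange x).2.le (hrange y).1.le (hrange y).2.le).1 hxy
    exact injOn_sin ⟨by linarith [hx.1, pi_pos], hx.2.le⟩ ⟨by linarith [hy.1, pi_pos], hy.2.le⟩
      (mul_left_cancel₀ hk0.ne' h1)
  have hcov := integral_image_eq_integral_abs_deriv_smul measurableSet_Ioo hderiv hinj
    (fun θ => h (sin θ ^ 2) / √(k ^ 2 - sin θ ^ 2))
  rw [image_arcsin_mul_sin hk0 hk1] at hcov
  rw [intervalIntegral.integral_of_le (by positivity), intervalIntegral.integral_of_le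
    (by positivity), integral_Ioc_eq_integral_Ioo, integral_Ioc_eq_integral_Ioo]
  rw [setIntegral_eq_of_subset_of_forall_sdiff_eq_zero measurableSet_Ioo
    (Set.Ioo_subset_Ioo_right hpi) (s := Set.Ioo 0 (arcsin k)), hcov]
  · refine setIntegral_congr_fun measurableSet_Ioo fun φ hφ => ?_
    have hc : 0 < cos φ := cos_pos_of_mem_Ioo ⟨by linarith [hφ.1, pi_pos], hφ.2⟩
    have hw : 0 < 1 - k ^ 2 * sin φ ^ 2 :=
      one_sub_sq_mul_sin_sq_pos (by nlinarith) φ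
    have hw' := sqrt_pos.2 hw
    have hkc : √(k ^ 2 - (k * sin φ) ^ 2) = k * cos φ := by
      rw [show k ^ 2 - (k * sin φ) ^ 2 = (k * cos φ) ^ 2 by
        rw [mul_pow, mul_pow, cos_sq']; ring, sqrt_sq (by positivity)]
    simp only [sin_arcsin (hrange φ).1.le (hrange φ).2.le, hkc, smul_eq_mul]
    rw [mul_pow, abs_of_pos (by positivity)]
    field_simp
  · intro θ ⟨⟨h0, h1⟩, hθ⟩
    have hθ' : arcsin k ≤ θ := not_lt.1 fun h => hθ ⟨h0, h⟩
    have hs : k ≤ sin θ := by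
      rw [← sin_arcsin (x := k) (by linarith) hk1.le]
      exact sin_le_sin_of_le_of_le_pi_div_two (by linarith [arcsin_pos.2 hk0, pi_pos]) h1.le hθ'
    rw [sqrt_eq_zero_of_nonpos (by nlinarith), div_zero]

/-- `avgcosOfSq u` is the average of `cos q` on the level set of squared modulus `u`. -/
lemma integral_cos_sub_avgcosOfSq_div_sqrt {u : ℝ} (hu : u ≠ 1) :
    ∫ q in Set.Ioc (-π) π, (cos q - avgcosOfSq u) / √(u - (1 - cos q) / 2) = 0 := by
  rcases le_or_gt u 0 with h0 | h0
  · simp_rw [fun q => sqrt_eq_zero_of_nonpos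
      (show u - (1 - cos q) / 2 ≤ 0 by linarith [cos_le_one q])]
    simp
  rw [integral_comp_cos_Ioc (fun c => (c - avgcosOfSq u) / √(u - (1 - c) / 2))]
  simp_rw [show ∀ θ, (1 - (1 - 2 * sin θ ^ 2)) / 2 = sin θ ^ 2 by intro θ; ring]
  rcases lt_or_gt_of_ne hu with h1 | h1
  · have hk0 := sqrt_pos.2 h0
    have hk1 : √u < 1 := by rwa [sqrt_lt' one_pos, one_pow]
    have hcov := integral_div_sqrt_sub_sin_sq hk0 hk1 (fun s => 1 - 2 * s - avgcosOfSq u)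
    have haff := integral_affine_div_sqrt (k := √u) (by nlinarith) (-1 - avgcosOfSq u) 2
    have havg := avgcosOfSq_mul_ellK_of_lt_one h1
    rw [sq_sqrt h0.le] at hcov haff
    rw [hcov]
    simp_rw [show ∀ φ, 1 - 2 * (u * sin φ ^ 2) - avgcosOfSq u
      = -1 - avgcosOfSq u + 2 * (1 - u * sin φ ^ 2) by intro φ; ring]
    rw [haff]
    linarith
  · have hk := sq_one_div_sqrt_lt_one h1
    have haff := integral_affine_div_sqrt hk (1 - 2 * u - avgcosOfSq u) (2 * u)
    have havg := avgcosOfSq_mul_ellK_of_one_lt h1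
    have hk2 : (1 / √u) ^ 2 = 1 / u := by rw [div_pow, sq_sqrt h0.le, one_pow]
    rw [hk2] at haff
    have hscale : ∀ φ, (1 - 2 * sin φ ^ 2 - avgcosOfSq u) / √(u - sin φ ^ 2)
        = 1 / √u * ((1 - 2 * u - avgcosOfSq u + 2 * u * (1 - 1 / u * sin φ ^ 2))
          / √(1 - 1 / u * sin φ ^ 2)) := fun φ => by
      rw [show u - sin φ ^ 2 = u * (1 - 1 / u * sin φ ^ 2) by field_simp, sqrt_mul h0.le,
        div_mul_div_comm, one_mul]
      congr 1
      field_simp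
      ring
    simp_rw [hscale]
    rw [intervalIntegral.integral_const_mul, haff]
    rw [show (1 - 2 * u - avgcosOfSq u) * ellK (1 / √u) + 2 * u * ellE (1 / √u) = 0 by linarith]
    simp

lemma image_sq_add_Ioi (s : ℝ) : (fun y : ℝ => y ^ 2 + s) '' Set.Ioi 0 = Set.Ioi s := by
  ext u
  simp only [Set.mem_image, Set.mem_Ioi]
  constructor
  · rintro ⟨y, hy, rfl⟩
    have := pow_pos hy 2
    linarith
  · intro hu
    exact ⟨√(u - s), sqrt_pos.2 (by linarith), by rw [sq_sqrt (by linarith)]; ring⟩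

lemma injOn_sq_add_Ioi (s : ℝ) : Set.InjOn (fun y : ℝ => y ^ 2 + s) (Set.Ioi 0) := by
  intro x hx y hy hxy
  exact (sq_eq_sq₀ (le_of_lt hx) (le_of_lt hy)).1 (by simpa using hxy)

lemma hasDerivWithinAt_sq_add (s y : ℝ) (t : Set ℝ) :
    HasDerivWithinAt (fun y : ℝ => y ^ 2 + s) (2 * y) t y := by
  simpa using ((hasDerivAt_pow 2 y).add_const s).hasDerivWithinAt

lemma abs_two_mul_smul_div_sqrt (f : ℝ → ℝ) (s : ℝ) {y : ℝ} (hy : 0 < y) :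
    |2 * y| • (f (y ^ 2 + s) / √(y ^ 2 + s - s)) = 2 * f (y ^ 2 + s) := by
  rw [add_sub_cancel_right, sqrt_sq hy.le, abs_of_pos (by positivity), smul_eq_mul]
  field_simp

lemma div_sqrt_sub_eq_zero (f : ℝ → ℝ) {s u : ℝ} (hu : u ∉ Set.Ioi s) :
    f u / √(u - s) = 0 := by
  rw [sqrt_eq_zero_of_nonpos (by linarith [Set.notMem_Ioi.1 hu]), div_zero]

lemma integral_comp_sq_add (f : ℝ → ℝ) (s : ℝ) :
    ∫ y, f (y ^ 2 + s) = ∫ u, f u / √(u - s) := by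
  have hcov := integral_image_eq_integral_abs_deriv_smul measurableSet_Ioi
    (fun y _ => hasDerivWithinAt_sq_add s y (Set.Ioi 0)) (injOn_sq_add_Ioi s)
    (fun u => f u / √(u - s))
  rw [image_sq_add_Ioi, setIntegral_eq_integral_of_forall_compl_eq_zero
    fun u hu => div_sqrt_sub_eq_zero f hu] at hcov
  have habs := integral_comp_abs (f := fun y => f (y ^ 2 + s))
  simp only [sq_abs] at habs
  rw [hcov, habs, ← integral_const_mul]
  exact setIntegral_congr_fun measurableSet_Ioi fun y hy => (abs_two_mul_smul_div_sqrt f s hy).symm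

lemma integrable_div_sqrt_sub {f : ℝ → ℝ} {s : ℝ} (hf : Integrable fun y => f (y ^ 2 + s)) :
    Integrable fun u => f u / √(u - s) := by
  have h := integrableOn_image_iff_integrableOn_abs_deriv_smul measurableSet_Ioi
    (fun y _ => hasDerivWithinAt_sq_add s y (Set.Ioi 0)) (injOn_sq_add_Ioi s)
    (fun u => f u / √(u - s))
  rw [image_sq_add_Ioi] at h
  refine (integrableOn_iff_integrable_of_support_subset fun u hu => ?_).1 (h.2 ?_)
  · by_contra hs
    exact hu (div_sqrt_sub_eq_zero f hs)
  · exact IntegrableOn.congr_fun (Integrable.integrableOn (hf.const_mul 2))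
      (fun y hy => (abs_two_mul_smul_div_sqrt f s hy).symm) measurableSet_Ioi

/-- The squared modulus `k²` of the pendulum orbit through `(q, p)`. -/
noncomputable def sqModulus (M q p : ℝ) : ℝ := (p^2 + 2*M*(1 - cos q)) / (4*M)

/-- Lebesgue measure on the phase cylinder `(-π, π] × ℝ`. -/
noncomputable def phaseMeasure : Measure (ℝ × ℝ) :=
  (volume.restrict (Set.Ioc (-π) π)).prod volume

lemma restrict_eq_phaseMeasure :
    (volume : Measure (ℝ × ℝ)).restrict (Set.Ioc (-π) π ×ˢ (Set.univ : Set ℝ))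
      = phaseMeasure := by
  rw [phaseMeasure, Measure.volume_eq_prod, ← Measure.prod_restrict, Measure.restrict_univ]

lemma sqModulus_eq {M : ℝ} (hM : 0 < M) (q p : ℝ) :
    sqModulus M q p = (p / (2 * √M)) ^ 2 + (1 - cos q) / 2 := by
  rw [sqModulus, div_pow, mul_pow, sq_sqrt hM.le]
  field_simp
  ring

lemma measurable_sqModulus (M : ℝ) : Measurable fun x : ℝ × ℝ => sqModulus M x.1 x.2 := by
  unfold sqModulus
  fun_prop

lemma sq_div_le_sqModulus {M : ℝ} (hM : 0 < M) (q p : ℝ) : p ^ 2 / (4 * M) ≤ sqModulus M q p := by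
  unfold sqModulus
  gcongr
  nlinarith [cos_le_one q]

lemma sqModulus_nonneg {M : ℝ} (hM : 0 < M) (q p : ℝ) : 0 ≤ sqModulus M q p :=
  le_trans (by positivity) (sq_div_le_sqModulus hM q p)

lemma integrable_of_bounded_of_sqModulus_lt {M : ℝ} (hM : 0 < M) {F : ℝ × ℝ → ℝ}
    (hF : Measurable F) {B R : ℝ} (hB : ∀ x, |F x| ≤ B)
    (hR : ∀ x, R ≤ sqModulus M x.1 x.2 → F x = 0) : Integrable F phaseMeasure := by
  have hdom : Integrable ((Set.Icc (-√(4 * M * R)) √(4 * M * R)).indicator fun _ : ℝ => B) :=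
    (integrable_indicator_iff measurableSet_Icc).2 (integrableOn_const (by simp))
  refine (hdom.comp_snd (volume.restrict (Set.Ioc (-π) π))).mono' hF.aestronglyMeasurable
    (ae_of_all _ fun x => ?_)
  rw [Real.norm_eq_abs]
  by_cases hx : x.2 ∈ Set.Icc (-√(4 * M * R)) √(4 * M * R)
  · rw [Set.indicator_of_mem hx]
    exact hB x
  · rw [Set.indicator_of_notMem hx, hR x, abs_zero]
    refine le_trans ?_ (sq_div_le_sqModulus hM x.1 x.2)
    rw [Set.mem_Icc, ← abs_le, not_le] at hx
    rw [sqrt_lt' ((sqrt_nonneg _).trans_lt hx), sq_abs] at hx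
    rw [le_div_iff₀ (by positivity)]
    linarith

lemma integrable_comp_sq_add_of_bounded {g : ℝ → ℝ} (hg : Measurable g) {B R s : ℝ} (hs : 0 ≤ s)
    (hB : ∀ u, |g u| ≤ B) (hR : ∀ u, R ≤ u → g u = 0) :
    Integrable (fun y => g (y ^ 2 + s)) ∧ ∫ y, |g (y ^ 2 + s)| ≤ B * (2 * √R) := by
  have hdom : Integrable ((Set.Icc (-√R) √R).indicator fun _ : ℝ => B) :=
    (integrable_indicator_iff measurableSet_Icc).2 (integrableOn_const (by simp))
  have hle : ∀ y, |g (y ^ 2 + s)| ≤ (Set.Icc (-√R) √R).indicator (fun _ : ℝ => B) y := fun y => by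
    by_cases hy : y ∈ Set.Icc (-√R) √R
    · rw [Set.indicator_of_mem hy]
      exact hB _
    · rw [Set.indicator_of_notMem hy, hR, abs_zero]
      rw [Set.mem_Icc, ← abs_le, not_le] at hy
      rw [sqrt_lt' ((sqrt_nonneg _).trans_lt hy), sq_abs] at hy
      linarith
  have hint : Integrable fun y => g (y ^ 2 + s) :=
    hdom.mono' (Measurable.aestronglyMeasurable (by fun_prop)) (ae_of_all _ hle)
  refine ⟨hint, (integral_mono hint.abs hdom hle).trans_eq ?_⟩
  rw [integral_indicator measurableSet_Icc, setIntegral_const, smul_eq_mul, Measure.real,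
    Real.volume_Icc, ENNReal.toReal_ofReal (by linarith [sqrt_nonneg R])]
  ring

lemma integrable_div_sqrt_phase {f : ℝ × ℝ → ℝ} (hf : Measurable f) {B R : ℝ}
    (hB : ∀ x, |f x| ≤ B) (hR : ∀ q u, R ≤ u → f (q, u) = 0) :
    Integrable (fun x => f x / √(x.2 - (1 - cos x.1) / 2)) phaseMeasure := by
  have hmeas : Measurable fun x : ℝ × ℝ => f x / √(x.2 - (1 - cos x.1) / 2) := by fun_prop
  have hbd := fun q => integrable_comp_sq_add_of_bounded (g := fun u => f (q, u)) (by fun_prop)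
    (show 0 ≤ (1 - cos q) / 2 by linarith [cos_le_one q]) (fun u => hB _) (hR q)
  refine (integrable_prod_iff hmeas.aestronglyMeasurable).2 ⟨ae_of_all _ fun q =>
    integrable_div_sqrt_sub (f := fun u => f (q, u)) (hbd q).1, ?_⟩
  refine (integrable_const (B * (2 * √R))).mono'
    hmeas.norm.stronglyMeasurable.integral_prod_right'.aestronglyMeasurable
    (ae_of_all _ fun q => ?_)
  rw [Real.norm_of_nonneg (integral_nonneg fun _ => norm_nonneg _)]
  refine Eq.trans_le ?_ (hbd q).2
  rw [integral_comp_sq_add (fun u => |f (q, u)|)]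
  simp_rw [norm_div, Real.norm_eq_abs, abs_of_nonneg (sqrt_nonneg _)]

/-- Functions of the energy do not see the difference between `cos q` and its angle average. -/
lemma integral_mul_cos_sub_avgcosOfSq {M : ℝ} (hM : 0 < M) {φ : ℝ → ℝ} (hφ : Measurable φ)
    {B R : ℝ} (hB : ∀ u, 0 ≤ u → |φ u| ≤ B) (hR : ∀ u, R ≤ u → φ u = 0) :
    Integrable (fun x => φ (sqModulus M x.1 x.2) *
        (cos x.1 - avgcosOfSq (sqModulus M x.1 x.2))) phaseMeasure ∧
      ∫ x, φ (sqModulus M x.1 x.2) * (cos x.1 - avgcosOfSq (sqModulus M x.1 x.2)) ∂phaseMeasure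
        = 0 := by
  obtain ⟨C, hC1, hC⟩ := exists_abs_avgcosOfSq_le
  have hA := measurable_avgcosOfSq
  have hu := measurable_sqModulus M
  set ψ : ℝ → ℝ := (Set.Ici 0).indicator φ with hψdef
  have hψ : Measurable ψ := hφ.indicator measurableSet_Ici
  have hψφ : ∀ u, 0 ≤ u → ψ u = φ u := fun u h => Set.indicator_of_mem (Set.mem_Ici.2 h) φ
  have hB0 : 0 ≤ B := (abs_nonneg _).trans (hB 0 le_rfl)
  have hψB : ∀ u, |ψ u| ≤ B := fun u => by
    by_cases h : u ∈ Set.Ici (0:ℝ)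
    · rw [hψφ u h]; exact hB u h
    · rw [hψdef, Set.indicator_of_notMem h, abs_zero]; exact hB0
  have hψR : ∀ u, R ≤ u → ψ u = 0 := fun u h => by
    by_cases h0 : u ∈ Set.Ici (0:ℝ)
    · rw [hψφ u h0]; exact hR u h
    · rw [hψdef, Set.indicator_of_notMem h0]
  simp_rw [← fun q p => hψφ _ (sqModulus_nonneg hM q p)]
  have hbd : ∀ q u, |ψ u * (cos q - avgcosOfSq u)| ≤ B * (1 + C) := fun q u => by
    rw [abs_mul]
    exact mul_le_mul (hψB u) ((abs_sub _ _).trans (add_le_add (abs_cos_le_one q) (hC u)))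
      (abs_nonneg _) hB0
  have hint : Integrable (fun x : ℝ × ℝ => ψ (sqModulus M x.1 x.2)
      * (cos x.1 - avgcosOfSq (sqModulus M x.1 x.2))) phaseMeasure :=
    integrable_of_bounded_of_sqModulus_lt hM (by fun_prop) (fun x => hbd _ _)
      (R := R) fun x hx => by rw [hψR _ hx, zero_mul]
  have hker := integrable_div_sqrt_phase (f := fun x => ψ x.2 * (cos x.1 - avgcosOfSq x.2))
    (by fun_prop) (fun x => hbd _ _) (R := R) fun q u hx => by simp only [hψR u hx, zero_mul]
  refine ⟨hint, ?_⟩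
  unfold phaseMeasure at hint hker ⊢
  rw [integral_prod _ hint]
  have hinner : ∀ q, ∫ p, ψ (sqModulus M q p) * (cos q - avgcosOfSq (sqModulus M q p))
      = |2 * √M| * ∫ u, ψ u * (cos q - avgcosOfSq u) / √(u - (1 - cos q) / 2) := fun q => by
    simp_rw [sqModulus_eq hM]
    rw [Measure.integral_comp_div (fun y => ψ (y ^ 2 + (1 - cos q) / 2) *
      (cos q - avgcosOfSq (y ^ 2 + (1 - cos q) / 2))), smul_eq_mul,
      integral_comp_sq_add (fun u => ψ u * (cos q - avgcosOfSq u))]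
  simp_rw [hinner]
  rw [integral_const_mul, integral_integral_swap
    (f := fun q u => ψ u * (cos q - avgcosOfSq u) / √(u - (1 - cos q) / 2)) hker,
    integral_eq_zero_of_ae, mul_zero]
  filter_upwards [Measure.ae_ne volume (1:ℝ)] with u hu1
  simp_rw [mul_div_assoc]
  rw [integral_const_mul, integral_cos_sub_avgcosOfSq_div_sqrt hu1, mul_zero, Pi.zero_apply]

lemma sqrt_sub_sqrt_sub_le {R s : ℝ} (hs0 : 0 ≤ s) (hs1 : s ≤ 1) (hR : 1 < R) :
    |√(R - s) - √R| ≤ 1 / √R := by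
  have h0 : 0 < √R := sqrt_pos.2 (by linarith)
  have h1 := sqrt_nonneg (R - s)
  have h2 : √(R - s) ≤ √R := sqrt_le_sqrt (by linarith)
  have h3 := sq_sqrt (show 0 ≤ R - s by linarith)
  have h4 := sq_sqrt (show 0 ≤ R by linarith)
  rw [abs_of_nonpos (by linarith), le_div_iff₀ h0]
  nlinarith

lemma abs_integral_truncated_le {R : ℝ} (hR : 1 < R) :
    |∫ q in (-π)..π, (4 / 3 * √(R - (1 - cos q) / 2) ^ 3 * cos q
      - 2 * √(R - (1 - cos q) / 2) * cos q ^ 2 + √(R - (1 - cos q) / 2) / 2)|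
      ≤ 3 * π / √R := by
  have hpos : ∀ q, 0 < R - (1 - cos q) / 2 := fun q => by linarith [neg_one_le_cos q]
  have hderiv : ∀ q, HasDerivAt (fun q => 4 / 3 * (√(R - (1 - cos q) / 2) ^ 3 * sin q)
      - 3 / 2 * √R * (sin q * cos q))
      (4 / 3 * √(R - (1 - cos q) / 2) ^ 3 * cos q - √(R - (1 - cos q) / 2) * sin q ^ 2
        - 3 / 2 * √R * (cos q ^ 2 - sin q ^ 2)) q := fun q => by
    have hs := sqrt_pos.2 (hpos q)
    have h1 : HasDerivAt (fun q => √(R - (1 - cos q) / 2))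
        (-(-(-sin q)) / 2 / (2 * √(R - (1 - cos q) / 2))) q := by
      refine HasDerivAt.sqrt ?_ (hpos q).ne'
      have := (((hasDerivAt_cos q).const_sub 1).div_const 2).const_sub R
      rwa [← neg_div] at this
    have h2 := (((h1.pow 3).mul (hasDerivAt_sin q)).const_mul (4 / 3)).sub
      (((hasDerivAt_sin q).mul (hasDerivAt_cos q)).const_mul (3 / 2 * √R))
    convert! h2 using 1
    simp only [Pi.pow_apply]
    generalize √(R - (1 - cos q) / 2) = r at hs ⊢
    field_simp
    ring
  have hftc := intervalIntegral.integral_eq_sub_of_hasDerivAt (a := -π) (b := π)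
    (fun q _ => hderiv q) (Continuous.intervalIntegrable (by fun_prop) _ _)
  simp only [sin_pi, sin_neg, neg_zero, mul_zero, zero_mul, sub_self] at hftc
  have hsplit : ∫ q in (-π)..π, (4 / 3 * √(R - (1 - cos q) / 2) ^ 3 * cos q
      - 2 * √(R - (1 - cos q) / 2) * cos q ^ 2 + √(R - (1 - cos q) / 2) / 2)
      = ∫ q in (-π)..π, (√(R - (1 - cos q) / 2) - √R) * (3 / 2 - 3 * cos q ^ 2) := by
    rw [← sub_zero (∫ q in (-π)..π, (4 / 3 * √(R - (1 - cos q) / 2) ^ 3 * cos q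
      - 2 * √(R - (1 - cos q) / 2) * cos q ^ 2 + √(R - (1 - cos q) / 2) / 2)), ← hftc,
      ← intervalIntegral.integral_sub (Continuous.intervalIntegrable (by fun_prop) _ _)
        (Continuous.intervalIntegrable (by fun_prop) _ _)]
    refine intervalIntegral.integral_congr fun q _ => ?_
    simp only [sin_sq]
    ring
  have hbound := intervalIntegral.norm_integral_le_of_norm_le_const (a := -π) (b := π)
    (f := fun q => (√(R - (1 - cos q) / 2) - √R) * (3 / 2 - 3 * cos q ^ 2))
    (C := 1 / √R * (3 / 2)) fun q _ => by
      rw [norm_mul, Real.norm_eq_abs, Real.norm_eq_abs]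
      refine mul_le_mul (sqrt_sub_sqrt_sub_le ?_ ?_ hR) ?_ (abs_nonneg _) (by positivity)
      · linarith [cos_le_one q]
      · linarith [neg_one_le_cos q]
      · rw [abs_le]
        constructor <;> nlinarith [cos_sq_le_one q, sq_nonneg (cos q)]
  rw [hsplit, ← Real.norm_eq_abs]
  refine hbound.trans_eq ?_
  rw [show π - -π = 2 * π by ring, abs_of_pos (by positivity)]
  ring

lemma setOf_sqModulus_lt {M R : ℝ} (hM : 0 < M) (q : ℝ) :
    {p | sqModulus M q p < R} = Set.Ioo (-(2 * √M * √(R - (1 - cos q) / 2)))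
      (2 * √M * √(R - (1 - cos q) / 2)) := by
  have hM' := sqrt_pos.2 hM
  ext p
  rw [Set.mem_ofPred_eq, sqModulus_eq hM, Set.mem_Ioo, ← abs_lt, ← lt_sub_iff_add_lt,
    ← sq_abs, ← lt_sqrt (abs_nonneg _), abs_div, abs_of_pos (by positivity : 0 < 2 * √M),
    div_lt_iff₀' (by positivity)]

lemma integral_sqModulus_lt_momentum {M : ℝ} (hM : 0 < M) (R q : ℝ) :
    ∫ p in {p | sqModulus M q p < R}, ((2 * sqModulus M q p - 1) * cos q + 1 / 4)
      = 2 * √M * (4 / 3 * √(R - (1 - cos q) / 2) ^ 3 * cos q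
      - 2 * √(R - (1 - cos q) / 2) * cos q ^ 2 + √(R - (1 - cos q) / 2) / 2) := by
  have hM' := sqrt_pos.2 hM
  rw [setOf_sqModulus_lt hM, ← integral_Ioc_eq_integral_Ioo, ← intervalIntegral.integral_of_le
    (neg_le_self (by positivity))]
  generalize √(R - (1 - cos q) / 2) = r
  have hpoly : ∀ p, (2 * sqModulus M q p - 1) * cos q + 1 / 4
      = cos q / (2 * M) * p ^ 2 + (1 / 4 - cos q ^ 2) := fun p => by
    unfold sqModulus; field_simp; ring
  simp_rw [hpoly]
  rw [intervalIntegral.integral_add (Continuous.intervalIntegrable (by fun_prop) _ _)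
    (Continuous.intervalIntegrable (by fun_prop) _ _), intervalIntegral.integral_const_mul,
    integral_pow, intervalIntegral.integral_const, smul_eq_mul]
  obtain ⟨t, ht⟩ : ∃ t, t = √M := ⟨_, rfl⟩
  have hMt : M = t ^ 2 := by rw [ht, sq_sqrt hM.le]
  rw [← ht] at hM' ⊢
  rw [hMt]
  field_simp
  norm_num
  ring

lemma integral_sqModulus_lt_phase {M R : ℝ} (hM : 0 < M) (hR : 1 < R) :
    IntegrableOn (fun x : ℝ × ℝ => (2 * sqModulus M x.1 x.2 - 1) * cos x.1 + 1 / 4)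
      {x | sqModulus M x.1 x.2 < R} phaseMeasure ∧
    |∫ x in {x | sqModulus M x.1 x.2 < R},
      ((2 * sqModulus M x.1 x.2 - 1) * cos x.1 + 1 / 4) ∂phaseMeasure|
        ≤ 2 * √M * (3 * π / √R) := by
  have hu := measurable_sqModulus M
  have hset : MeasurableSet {x : ℝ × ℝ | sqModulus M x.1 x.2 < R} :=
    measurableSet_lt hu measurable_const
  have hmeas : Measurable fun x : ℝ × ℝ => (2 * sqModulus M x.1 x.2 - 1) * cos x.1 + 1 / 4 := by
    fun_prop
  have hint := integrable_of_bounded_of_sqModulus_lt hM (hmeas.indicator hset)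
    (B := 2 * R + 2) (R := R) (fun x => by
      by_cases hx : sqModulus M x.1 x.2 < R
      · rw [Set.indicator_of_mem (s := {x : ℝ × ℝ | sqModulus M x.1 x.2 < R}) hx]
        have h0 := sqModulus_nonneg hM x.1 x.2
        have h1 : |(2 * sqModulus M x.1 x.2 - 1) * cos x.1| ≤ (2 * R + 1) * 1 := by
          rw [abs_mul]
          refine mul_le_mul ?_ (abs_cos_le_one _) (abs_nonneg _) (by linarith)
          rw [abs_le]; constructor <;> linarith
        refine (abs_add_le _ _).trans ?_
        rw [abs_of_pos (by norm_num : (0:ℝ) < 1 / 4)]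
        linarith
      · rw [Set.indicator_of_notMem (s := {x : ℝ × ℝ | sqModulus M x.1 x.2 < R}) hx, abs_zero]
        linarith)
    (fun x hx => Set.indicator_of_notMem
      (s := {x : ℝ × ℝ | sqModulus M x.1 x.2 < R}) (not_lt.2 hx) _)
  refine ⟨(integrable_indicator_iff hset).1 hint, ?_⟩
  rw [← integral_indicator hset]
  unfold phaseMeasure at hint ⊢
  rw [integral_prod _ hint]
  have hinner : ∀ q, ∫ p, {x : ℝ × ℝ | sqModulus M x.1 x.2 < R}.indicator
      (fun x => (2 * sqModulus M x.1 x.2 - 1) * cos x.1 + 1 / 4) (q, p)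
      = 2 * √M * (4 / 3 * √(R - (1 - cos q) / 2) ^ 3 * cos q
        - 2 * √(R - (1 - cos q) / 2) * cos q ^ 2 + √(R - (1 - cos q) / 2) / 2) := fun q => by
    rw [← integral_sqModulus_lt_momentum hM R, ← integral_indicator
      (setOf_sqModulus_lt (R := R) hM q ▸ measurableSet_Ioo)]
    rfl
  simp_rw [hinner]
  rw [integral_const_mul, ← intervalIntegral.integral_of_le (by linarith [pi_pos]), abs_mul,
    abs_of_nonneg (by positivity)]
  gcongr
  exact abs_integral_truncated_le hR

lemma integrable_of_le_div_sqModulus {M : ℝ} (hM : 0 < M) {F : ℝ × ℝ → ℝ} (hF : Measurable F)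
    {a b : ℝ} (ha : 0 ≤ a) (hb : 0 ≤ b) (hFa : ∀ x, sqModulus M x.1 x.2 < 2 → |F x| ≤ a)
    (hFb : ∀ x, 2 ≤ sqModulus M x.1 x.2 → |F x| ≤ b / sqModulus M x.1 x.2) :
    Integrable F phaseMeasure := by
  have hM' := sqrt_pos.2 hM
  have hdom : Integrable fun p : ℝ => (3 * a + 2 * b) * (1 + (p / (2 * √M)) ^ 2)⁻¹ :=
    (integrable_inv_one_add_sq.comp_div (by positivity)).const_mul _
  refine (hdom.comp_snd (volume.restrict (Set.Ioc (-π) π))).mono' hF.aestronglyMeasurable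
    (ae_of_all _ fun x => ?_)
  have hu : (x.2 / (2 * √M)) ^ 2 ≤ sqModulus M x.1 x.2 := by
    rw [sqModulus_eq hM]; linarith [cos_le_one x.1]
  have hy := sq_nonneg (x.2 / (2 * √M))
  have ha' := hFa x
  have hb' := hFb x
  generalize (x.2 / (2 * √M)) ^ 2 = y at hu hy
  generalize sqModulus M x.1 x.2 = u at hu ha' hb'
  rw [Real.norm_eq_abs, ← div_eq_mul_inv, le_div_iff₀ (by linarith)]
  have h0 := abs_nonneg (F x)
  rcases lt_or_ge u 2 with h | h
  · nlinarith [ha' h]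
  · have h1 := (le_div_iff₀ (by linarith)).1 (hb' h)
    nlinarith

lemma sq_div_two_eq_sqModulus {M : ℝ} (hM : 0 < M) (q p : ℝ) :
    p ^ 2 / 2 = M * (2 * sqModulus M q p - 1 + cos q) := by
  unfold sqModulus; field_simp; ring

lemma integrable_kinetic_mul_avgcosOfSq {M : ℝ} (hM : 0 < M) :
    Integrable (fun x : ℝ × ℝ => x.2 ^ 2 / 2 * avgcosOfSq (sqModulus M x.1 x.2) + M / 4)
      phaseMeasure := by
  obtain ⟨C, hC1, hC⟩ := exists_abs_avgcosOfSq_le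
  have hA := measurable_avgcosOfSq
  have hu := measurable_sqModulus M
  refine integrable_of_le_div_sqModulus hM (by fun_prop) (a := 4 * M * C + M) (b := 7 * M)
    (by positivity) (by positivity) (fun x hx => ?_) (fun x hx => ?_)
  · have h1 : |x.2 ^ 2 / 2 * avgcosOfSq (sqModulus M x.1 x.2)| ≤ 4 * M * C := by
      rw [abs_mul, abs_of_nonneg (by positivity)]
      refine mul_le_mul ?_ (hC _) (abs_nonneg _) (by positivity)
      have := (sq_div_le_sqModulus hM x.1 x.2).trans_lt hx
      rw [div_lt_iff₀ (by positivity)] at this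
      linarith
    refine (abs_add_le _ _).trans ?_
    rw [abs_of_pos (by positivity : 0 < M / 4)]
    linarith
  · have hkin := sq_div_two_eq_sqModulus hM x.1 x.2
    have hp := sq_nonneg x.2
    have hasym := abs_avgcosOfSq_add_le hx
    have hc1 := cos_le_one x.1
    have hc2 := neg_one_le_cos x.1
    generalize sqModulus M x.1 x.2 = u at hx hkin hasym ⊢
    have hupos : 0 < u := by linarith
    have hsplit : x.2 ^ 2 / 2 * avgcosOfSq u + M / 4
        = x.2 ^ 2 / 2 * (avgcosOfSq u + 1 / (8 * u)) + M * (1 - cos x.1) / (8 * u) := by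
      rw [hkin]; field_simp; ring
    have h1 : |x.2 ^ 2 / 2 * (avgcosOfSq u + 1 / (8 * u))| ≤ 2 * M * u * (3 / u ^ 2) := by
      rw [abs_mul, abs_of_nonneg (by positivity)]
      refine mul_le_mul ?_ hasym (abs_nonneg _) (by positivity)
      rw [hkin]; nlinarith
    have h2 : |M * (1 - cos x.1) / (8 * u)| ≤ M * 2 / (8 * u) := by
      rw [abs_of_nonneg (div_nonneg (mul_nonneg hM.le (by linarith)) (by positivity))]
      gcongr
      linarith
    rw [hsplit]
    refine (abs_add_le _ _).trans ((add_le_add h1 h2).trans ?_)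
    rw [show 2 * M * u * (3 / u ^ 2) + M * 2 / (8 * u) = (25 / 4 * M) / u by field_simp; ring]
    gcongr
    norm_num

lemma integrable_avgcosOfSq_sq {M : ℝ} (hM : 0 < M) :
    Integrable (fun x : ℝ × ℝ => avgcosOfSq (sqModulus M x.1 x.2) ^ 2) phaseMeasure := by
  obtain ⟨C, hC1, hC⟩ := exists_abs_avgcosOfSq_le
  have hA := measurable_avgcosOfSq
  have hu := measurable_sqModulus M
  refine integrable_of_le_div_sqModulus hM (by fun_prop) (a := C * C) (b := C * 2)
    (by positivity) (by positivity) (fun x hx => ?_) (fun x hx => ?_)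
  · rw [sq, abs_mul]
    exact mul_le_mul (hC _) (hC _) (abs_nonneg _) (by positivity)
  · rw [sq, abs_mul, mul_div_assoc]
    refine mul_le_mul (hC _) ?_ (abs_nonneg _) (by positivity)
    have hasym := abs_avgcosOfSq_add_le hx
    generalize sqModulus M x.1 x.2 = u at hx hasym ⊢
    have hupos : 0 < u := by linarith
    have h1 := abs_sub_abs_le_abs_sub (avgcosOfSq u) (-(1 / (8 * u)))
    rw [sub_neg_eq_add, abs_neg, abs_of_pos (by positivity : 0 < 1 / (8 * u))] at h1
    have h2 : 1 / (8 * u) + 3 / u ^ 2 ≤ 2 / u := by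
      rw [show 1 / (8 * u) + 3 / u ^ 2 = (1 / 8 + 3 / u) / u by field_simp]
      gcongr
      have : 3 / u ≤ 3 / 2 := by gcongr
      linarith
    linarith

lemma abs_integral_sqModulus_lt_le {M R : ℝ} (hM : 0 < M) (hR : 1 < R) :
    |∫ x in {x | sqModulus M x.1 x.2 < R},
      (x.2 ^ 2 / 2 * avgcosOfSq (sqModulus M x.1 x.2) + M / 4
        - M * avgcosOfSq (sqModulus M x.1 x.2) ^ 2) ∂phaseMeasure|
      ≤ M * (2 * √M * (3 * π / √R)) := by
  obtain ⟨C, hC1, hC⟩ := exists_abs_avgcosOfSq_le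
  have hA := measurable_avgcosOfSq
  have hset : MeasurableSet {x : ℝ × ℝ | sqModulus M x.1 x.2 < R} :=
    measurableSet_lt (measurable_sqModulus M) measurable_const
  obtain ⟨hint, hbound⟩ := integral_sqModulus_lt_phase hM hR
  obtain ⟨havgint, havg⟩ := integral_mul_cos_sub_avgcosOfSq hM
    (φ := (Set.Iio R).indicator fun u => avgcosOfSq u - (2 * u - 1)) (B := C + (2 * R + 1)) (R := R)
    (Measurable.indicator (by fun_prop) measurableSet_Iio)
    (fun u hu => by
      by_cases h : u < R
      · rw [Set.indicator_of_mem (Set.mem_Iio.2 h)]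
        refine (abs_sub _ _).trans (add_le_add (hC u) ?_)
        rw [abs_le]; constructor <;> linarith
      · rw [Set.indicator_of_notMem (by simpa using h), abs_zero]
        linarith)
    (fun u hu => Set.indicator_of_notMem (by simpa using hu) _)
  have hsplit : ∀ x, {x : ℝ × ℝ | sqModulus M x.1 x.2 < R}.indicator
      (fun x => x.2 ^ 2 / 2 * avgcosOfSq (sqModulus M x.1 x.2) + M / 4
        - M * avgcosOfSq (sqModulus M x.1 x.2) ^ 2) x
      = M * ((Set.Iio R).indicator (fun u => avgcosOfSq u - (2 * u - 1)) (sqModulus M x.1 x.2) *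
          (cos x.1 - avgcosOfSq (sqModulus M x.1 x.2))
        + {x : ℝ × ℝ | sqModulus M x.1 x.2 < R}.indicator
          (fun x => (2 * sqModulus M x.1 x.2 - 1) * cos x.1 + 1 / 4) x) := fun x => by
    simp only [Set.indicator_apply, Set.mem_ofPred_eq, Set.mem_Iio,
      sq_div_two_eq_sqModulus hM x.1 x.2]
    split_ifs <;> ring
  rw [← integral_indicator hset]
  simp_rw [hsplit]
  rw [integral_const_mul, integral_add havgint ((integrable_indicator_iff hset).2 hint), havg,
    zero_add, integral_indicator hset, abs_mul, abs_of_pos hM]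
  gcongr

theorem integral_p2_avgcos (M : ℝ) (hM : 0 < M) :
    ∫ x in Set.Ioc (-π) π ×ˢ (Set.univ : Set ℝ),
        ((x.2^2/2) * avgcos M x.1 x.2 + M/4)
      = M * ∫ x in Set.Ioc (-π) π ×ˢ (Set.univ : Set ℝ),
          (avgcos M x.1 x.2)^2 := by
  rw [restrict_eq_phaseMeasure]
  simp_rw [avgcos_eq_avgcosOfSq, ← sqModulus.eq_def]
  have hkin := integrable_kinetic_mul_avgcosOfSq hM
  have hsq := (integrable_avgcosOfSq_sq hM).const_mul M
  rw [← integral_const_mul, ← sub_eq_zero, ← integral_sub hkin hsq]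
  have hlim := tendsto_setIntegral_of_monotone (μ := phaseMeasure)
    (s := fun R : ℝ => {x : ℝ × ℝ | sqModulus M x.1 x.2 < R})
    (fun R => measurableSet_lt (measurable_sqModulus M) measurable_const)
    (fun R R' h x hx => lt_of_lt_of_le hx h) (hkin.sub hsq).integrableOn
  have hunion : ⋃ R : ℝ, {x : ℝ × ℝ | sqModulus M x.1 x.2 < R} = Set.univ :=
    Set.iUnion_eq_univ_iff.2 fun x => exists_gt (sqModulus M x.1 x.2)
  rw [hunion, setIntegral_univ] at hlim
  refine tendsto_nhds_unique hlim (squeeze_zero_norm' ?_ (a := fun R => M * (2 * √M *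
    (3 * π / √R))) ?_)
  · filter_upwards [Filter.eventually_gt_atTop 1] with R hR
    exact abs_integral_sqModulus_lt_le hM hR
  · simpa using ((tendsto_const_nhds.div_atTop tendsto_sqrt_atTop).const_mul (2 * √M)).const_mul M
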